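/- Let E be a complex Banach space and let T ∈ B(E) be an invertible operator (with bounded inverse T⁻¹) such that the Deddens algebra D_T is closed in the operator norm topology. Then there is a constant M > 0 such that ‖TⁿXT⁻ⁿ‖ ≤ M‖X‖ for all n ∈ ℕ and all X ∈ D_T. -/

import Mathlib

/-- `X` belongs to the Deddens algebra `D_T` associated with `T`: there is a constant
`M > 0` such that `‖Tⁿ X f‖ ≤ M ‖Tⁿ f‖` for all `n` and `f`. -/
def InDeddens {E : Type*} [NormedAddCommGroup E] [NormedSpace ℂ E]
    (T X : E →L[ℂ] E) : Prop :=
  ∃ M > (0 : ℝ), ∀ (n : ℕ) (f : E), ‖(T ^ n) (X f)‖ ≤ M * ‖(T ^ n) f‖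

/-- The Deddens algebra as a subspace. -/
def deddensSubmodule {E : Type*} [NormedAddCommGroup E] [NormedSpace ℂ E]
    (T : E →L[ℂ] E) : Submodule ℂ (E →L[ℂ] E) :=
  { carrier := {X | InDeddens T X}
    add_mem' := by
      rintro X Y ⟨M, hM, hX⟩ ⟨N, hN, hY⟩
      refine ⟨M + N, by positivity, fun n f => ?_⟩
      have h := norm_add_le ((T ^ n) (X f)) ((T ^ n) (Y f))
      rw [add_apply, map_add]
      linarith [hX n f, hY n f]
    zero_mem' := ⟨1, one_pos, fun n f => by simp⟩
    smul_mem' := by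
      rintro c X ⟨M, hM, hX⟩
      refine ⟨(‖c‖ + 1) * M, by positivity, fun n f => ?_⟩
      rw [smul_apply, map_smul, norm_smul]
      have h1 := mul_le_mul_of_nonneg_left (hX n f) (norm_nonneg c)
      have h2 : 0 ≤ M * ‖(T ^ n) f‖ := by positivity
      linarith }

/-- Uniform boundedness on a closed subspace. -/
theorem bound_on_submodule {V : Type*} [NormedAddCommGroup V] [NormedSpace ℂ V] [CompleteSpace V]
    (D : Submodule ℂ V) (hD : IsClosed (D : Set V)) (L : ℕ → V →L[ℂ] V)
    (hb : ∀ X ∈ D, ∃ C, ∀ n, ‖L n X‖ ≤ C) :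
    ∃ M > (0 : ℝ), ∀ (n : ℕ), ∀ X ∈ D, ‖L n X‖ ≤ M * ‖X‖ := by
  have : CompleteSpace D := hD.completeSpace_coe
  obtain ⟨C, hC⟩ := banach_steinhaus (g := fun n => (L n).comp D.subtypeL)
    (fun X => hb X.1 X.2)
  refine ⟨|C| + 1, by positivity, fun n X hX => ?_⟩
  have h := ((L n).comp D.subtypeL).le_opNorm ⟨X, hX⟩
  refine h.trans ?_
  refine mul_le_mul_of_nonneg_right ?_ (norm_nonneg _)
  linarith [hC n, le_abs_self C]

/-- If `T` is invertible with bounded inverse `S` and its Deddens algebra is closed in the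
operator norm topology, then there is a constant `M > 0` with `‖Tⁿ X T⁻ⁿ‖ ≤ M ‖X‖` for all
`n ∈ ℕ` and all `X ∈ D_T`. -/
theorem deddens_closed_uniform_bound_of_invertible
    {E : Type*} [NormedAddCommGroup E] [NormedSpace ℂ E] [CompleteSpace E]
    (T S : E →L[ℂ] E) (hTS : T ∘L S = 1) (hST : S ∘L T = 1)
    (hclosed : IsClosed {X : E →L[ℂ] E | InDeddens T X}) :
    ∃ M > (0 : ℝ), ∀ (n : ℕ) (X : E →L[ℂ] E), InDeddens T X →
      ‖(T ^ n) ∘L X ∘L (S ^ n)‖ ≤ M * ‖X‖ := by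
  have hpow : ∀ n : ℕ, T ^ n * S ^ n = 1 := fun n => pow_mul_pow_eq_one n hTS
  have hL : ∀ n (X : E →L[ℂ] E), ContinuousLinearMap.mulLeftRight ℂ (E →L[ℂ] E) (T ^ n) (S ^ n) X
      = (T ^ n) ∘L X ∘L (S ^ n) := by
    intro n X
    ext f
    simp
  have key := bound_on_submodule (deddensSubmodule T) hclosed
    (fun n => ContinuousLinearMap.mulLeftRight ℂ (E →L[ℂ] E) (T ^ n) (S ^ n))
  simp only [hL] at key
  refine key ?_
  rintro X ⟨M, hM, hX⟩
  refine ⟨M, fun n => ?_⟩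
  refine ContinuousLinearMap.opNorm_le_bound _ hM.le fun f => ?_
  have h := hX n ((S ^ n) f)
  have h2 : (T ^ n) ((S ^ n) f) = f := by
    have := congrArg (fun A : E →L[ℂ] E => A f) (hpow n)
    simpa using this
  rw [h2] at h
  exact h
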